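/- arXiv:1703.10521 — 2 statements merged into one kernel-verified Lean document; each statement's English description precedes it below -/
import Mathlib

section
/- For $K = \mathbb{Q}(\imath\sqrt{2})$, with $D_K$ the convex polygon with vertices $1, \imath\sqrt{2}, -1, -\imath\sqrt{2}$, the polygon $P$ with vertices $3, \imath\sqrt{2}, -3, -\imath\sqrt{2}$ belongs to $\widetilde{\mathcal{C}_{\mathcal{O}_K}}$ but not to the sub-semiring $\mathcal{C}_{\mathcal{O}_K}$ generated by $\{h \cdot D_K : h \in \mathcal{O}_K\}$; hence $\mathcal{C}_{\mathcal{O}_K} \subsetneq \widetilde{\mathcal{C}_{\mathcal{O}_K}}$. -/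
open Pointwise

/-- The sub-semiring of subsets of `ℂ` generated by a family `G` (for the operations
convex hull of union and Minkowski sum), together with the neutral elements `∅`, `{0}`. -/
def genSemiring (G : Set (Set ℂ)) : Set (Set ℂ) :=
  ⋂₀ {T : Set (Set ℂ) | G ⊆ T ∧ ∅ ∈ T ∧ {(0 : ℂ)} ∈ T ∧
      (∀ A ∈ T, ∀ B ∈ T, convexHull ℝ (A ∪ B) ∈ T) ∧
      (∀ A ∈ T, ∀ B ∈ T, A + B ∈ T)}

def OO : Set ℂ := {z : ℂ | ∃ a b : ℤ, z = (a : ℂ) + (b : ℂ) * (Complex.I * Real.sqrt 2)}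

def Good (C : Set ℂ) : Prop :=
  (∃ S : Finset ℂ, (↑S : Set ℂ) ⊆ OO ∧ C = convexHull ℝ ↑S) ∧ (interior C).Nonempty ∧ C = -C

lemma sqrt2_pos : 0 < Real.sqrt 2 := by positivity

lemma interior_of_mem {C : Set ℂ} (hc : Convex ℝ C) (h0 : (0 : ℂ) ∈ C) (h1 : (1 : ℂ) ∈ C)
    (hs : Complex.I * (Real.sqrt 2 : ℂ) ∈ C) : (interior C).Nonempty := by
  have hp := sqrt2_pos
  have hsq : Real.sqrt 2 * Real.sqrt 2 = 2 := Real.mul_self_sqrt (by norm_num)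
  have hopen : IsOpen {z : ℂ | 0 < z.re ∧ 0 < z.im ∧ z.re + z.im / Real.sqrt 2 < 1} := by
    refine IsOpen.and ?_ (IsOpen.and ?_ ?_)
    · exact isOpen_lt continuous_const Complex.continuous_re
    · exact isOpen_lt continuous_const Complex.continuous_im
    · exact isOpen_lt (by fun_prop) continuous_const
  refine ⟨⟨1/4, Real.sqrt 2 / 4⟩, mem_interior.2 ⟨_, ?_, hopen, ?_⟩⟩
  · rintro z ⟨ha, hb, hab⟩
    have hb' : 0 < z.im / Real.sqrt 2 := by positivity
    have := hc.sum_mem (t := Finset.univ)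
      (w := ![z.re, z.im / Real.sqrt 2, 1 - z.re - z.im / Real.sqrt 2])
      (z := ![1, Complex.I * (Real.sqrt 2 : ℂ), 0])
      (by intro i _; fin_cases i <;> simp <;> linarith)
      (by simp [Fin.sum_univ_three])
      (by intro i _; fin_cases i <;> simp [h0, h1, hs])
    convert this using 1
    apply Complex.ext
    · simp [Fin.sum_univ_three, -Complex.real_smul, Complex.smul_re]
    · simp [Fin.sum_univ_three, -Complex.real_smul, Complex.smul_im]
  · refine ⟨by norm_num, by simp, ?_⟩
    have : Real.sqrt 2 / 4 / Real.sqrt 2 = 1/4 := by field_simp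
    simp only [this]; norm_num

lemma zero_mem_of_symm {C : Set ℂ} (hc : Convex ℝ C) (hn : C.Nonempty) (hs : C = -C) :
    (0 : ℂ) ∈ C := by
  obtain ⟨z, hz⟩ := hn
  have hz' : -z ∈ C := by rw [hs]; simpa using hz
  have := hc hz hz' (a := 1/2) (b := 1/2) (by norm_num) (by norm_num) (by norm_num)
  simpa using this

lemma Good.convex {C : Set ℂ} (h : Good C) : Convex ℝ C := by
  obtain ⟨⟨S, -, rfl⟩, -⟩ := h
  exact convex_convexHull ℝ _

lemma Good.zero_mem {C : Set ℂ} (h : Good C) : (0 : ℂ) ∈ C :=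
  zero_mem_of_symm h.convex (h.2.1.mono interior_subset) h.2.2

lemma OO_neg {z : ℂ} (h : z ∈ OO) : -z ∈ OO := by
  obtain ⟨a, b, rfl⟩ := h
  exact ⟨-a, -b, by push_cast; ring⟩

lemma OO_add {z w : ℂ} (h : z ∈ OO) (h' : w ∈ OO) : z + w ∈ OO := by
  obtain ⟨a, b, rfl⟩ := h
  obtain ⟨c, d, rfl⟩ := h'
  exact ⟨a + c, b + d, by push_cast; ring⟩

lemma s2_sq : (Complex.I * (Real.sqrt 2 : ℂ)) * (Complex.I * (Real.sqrt 2 : ℂ)) = -2 := by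
  have h2 : (Real.sqrt 2 : ℂ) * (Real.sqrt 2 : ℂ) = 2 := by
    rw [← Complex.ofReal_mul, Real.mul_self_sqrt (by norm_num)]; norm_num
  linear_combination (Complex.I * Complex.I) * h2 + 2 * Complex.I_mul_I

lemma OO_mul {z w : ℂ} (h : z ∈ OO) (h' : w ∈ OO) : z * w ∈ OO := by
  obtain ⟨a, b, rfl⟩ := h
  obtain ⟨c, d, rfl⟩ := h'
  refine ⟨a * c - 2 * b * d, a * d + b * c, ?_⟩
  push_cast
  linear_combination (b * d : ℂ) * s2_sq

lemma int_mem_OO (n : ℤ) : (n : ℂ) ∈ OO := ⟨n, 0, by simp⟩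

lemma s2_mem_OO : Complex.I * (Real.sqrt 2 : ℂ) ∈ OO := ⟨0, 1, by simp⟩

lemma neg_four (n s : ℂ) : -({n, s, -n, -s} : Set ℂ) = {n, s, -n, -s} := by
  ext z
  simp only [Set.mem_neg, Set.mem_insert_iff, Set.mem_singleton_iff, neg_eq_iff_eq_neg,
    neg_neg]
  tauto

lemma good_four (n : ℤ) (hn : 1 ≤ n) :
    Good (convexHull ℝ ({(n : ℂ), Complex.I * (Real.sqrt 2 : ℂ), -(n : ℂ),
      -(Complex.I * (Real.sqrt 2 : ℂ))} : Set ℂ)) := by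
  classical
  have hsym : convexHull ℝ ({(n : ℂ), Complex.I * (Real.sqrt 2 : ℂ), -(n : ℂ),
      -(Complex.I * (Real.sqrt 2 : ℂ))} : Set ℂ) = -convexHull ℝ ({(n : ℂ),
      Complex.I * (Real.sqrt 2 : ℂ), -(n : ℂ), -(Complex.I * (Real.sqrt 2 : ℂ))} : Set ℂ) := by
    rw [← convexHull_neg, neg_four]
  have hc := convex_convexHull ℝ ({(n : ℂ), Complex.I * (Real.sqrt 2 : ℂ), -(n : ℂ),
      -(Complex.I * (Real.sqrt 2 : ℂ))} : Set ℂ)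
  have hnm := subset_convexHull ℝ ({(n : ℂ), Complex.I * (Real.sqrt 2 : ℂ), -(n : ℂ),
      -(Complex.I * (Real.sqrt 2 : ℂ))} : Set ℂ) (Set.mem_insert _ _)
  have hsm := subset_convexHull ℝ ({(n : ℂ), Complex.I * (Real.sqrt 2 : ℂ), -(n : ℂ),
      -(Complex.I * (Real.sqrt 2 : ℂ))} : Set ℂ) (Set.mem_insert_of_mem _ (Set.mem_insert _ _))
  have h0 := zero_mem_of_symm hc ⟨_, hnm⟩ hsym
  refine ⟨⟨{(n : ℂ), Complex.I * (Real.sqrt 2 : ℂ), -(n : ℂ),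
      -(Complex.I * (Real.sqrt 2 : ℂ))}, ?_, by simp⟩, ?_, hsym⟩
  · intro z hz
    simp only [Finset.coe_insert, Finset.coe_singleton, Set.mem_insert_iff,
      Set.mem_singleton_iff] at hz
    rcases hz with rfl | rfl | rfl | rfl
    · exact int_mem_OO n
    · exact s2_mem_OO
    · exact OO_neg (int_mem_OO n)
    · exact OO_neg s2_mem_OO
  · refine interior_of_mem hc h0 ?_ hsm
    have hn' : (1 : ℝ) ≤ n := by exact_mod_cast hn
    have hn0 : (n : ℂ) ≠ 0 := by
      have : n ≠ 0 := by omega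
      exact_mod_cast this
    have := hc h0 hnm (a := 1 - 1 / (n : ℝ)) (b := 1 / (n : ℝ))
      (by rw [sub_nonneg, div_le_one (by linarith)]; exact hn') (by positivity) (by ring)
    simpa [hn0] using this

lemma Good.hull {A B : Set ℂ} (hA : Good A) (hB : Good B) : Good (convexHull ℝ (A ∪ B)) := by
  classical
  have hi : (interior (convexHull ℝ (A ∪ B))).Nonempty :=
    hA.2.1.mono (interior_mono (Set.subset_union_left.trans (subset_convexHull ℝ _)))
  refine ⟨?_, hi, ?_⟩
  · obtain ⟨⟨S, hS, rfl⟩, -⟩ := hA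
    obtain ⟨⟨S', hS', rfl⟩, -⟩ := hB
    refine ⟨S ∪ S', by simp [hS, hS'], ?_⟩
    rw [Finset.coe_union, convexHull_convexHull_union_left, convexHull_convexHull_union_right]
  · rw [← convexHull_neg, Set.union_neg, ← hA.2.2, ← hB.2.2]

lemma Good.add {A B : Set ℂ} (hA : Good A) (hB : Good B) : Good (A + B) := by
  classical
  have hi : (interior (A + B)).Nonempty :=
    hA.2.1.mono (interior_mono (fun x hx => ⟨x, hx, 0, hB.zero_mem, by simp⟩))
  refine ⟨?_, hi, ?_⟩
  · obtain ⟨⟨S, hS, rfl⟩, -⟩ := hA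
    obtain ⟨⟨S', hS', rfl⟩, -⟩ := hB
    refine ⟨S + S', ?_, ?_⟩
    · rw [Finset.coe_add]
      rintro _ ⟨a, ha, b, hb, rfl⟩
      exact OO_add (hS ha) (hS' hb)
    · rw [Finset.coe_add, convexHull_add]
  · rw [neg_add, ← hA.2.2, ← hB.2.2]

lemma Good.smul {A : Set ℂ} (hA : Good A) {h : ℂ} (hh : h ∈ OO) (h0 : h ≠ 0) : Good (h • A) := by
  classical
  refine ⟨?_, ?_, ?_⟩
  · obtain ⟨⟨S, hS, rfl⟩, -⟩ := hA
    refine ⟨h • S, ?_, ?_⟩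
    · rw [Finset.coe_smul_finset]
      rintro _ ⟨a, ha, rfl⟩
      exact OO_mul hh (hS ha)
    · rw [Finset.coe_smul_finset]
      exact LinearMap.image_convexHull (LinearMap.mulLeft ℝ h) (S : Set ℂ)
  · rw [interior_smul₀ h0]
    exact hA.2.1.smul_set
  · rw [← Set.smul_set_neg, ← hA.2.2]

/-- A convex outer description of `P`. -/
def R : Set ℂ := {z : ℂ | |z.re| + 3 * |z.im / Real.sqrt 2| ≤ 3}

lemma R_int {a b : ℤ} (h : (a : ℂ) + (b : ℂ) * (Complex.I * Real.sqrt 2) ∈ R) :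
    |a| + 3 * |b| ≤ 3 := by
  have hp := sqrt2_pos.ne'
  simp only [R, Set.mem_ofPred_eq] at h
  simp [hp] at h
  exact_mod_cast h

lemma convex_R : Convex ℝ R := by
  intro x hx y hy a b ha hb hab
  simp only [R, Set.mem_ofPred_eq] at *
  simp only [Complex.add_re, Complex.add_im, Complex.smul_re, Complex.smul_im, smul_eq_mul]
  have e : (a * x.im + b * y.im) / Real.sqrt 2
      = a * (x.im / Real.sqrt 2) + b * (y.im / Real.sqrt 2) := by ring
  rw [e]
  have h1 := abs_add_le (a * x.re) (b * y.re)
  have h2 := abs_add_le (a * (x.im / Real.sqrt 2)) (b * (y.im / Real.sqrt 2))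
  simp only [abs_mul, abs_of_nonneg ha, abs_of_nonneg hb] at h1 h2
  have h3 := mul_le_mul_of_nonneg_left hx ha
  have h4 := mul_le_mul_of_nonneg_left hy hb
  have : 3 = a * 3 + b * 3 := by linear_combination -3 * hab
  linarith

lemma extreme {S : Set ℂ} (hS : S ⊆ R) (h : (3 : ℂ) ∈ convexHull ℝ S) : (3 : ℂ) ∈ S := by
  by_contra hn
  have hsub : S ⊆ {z : ℂ | z.re < 3} := by
    intro z hz
    by_contra hlt
    simp only [Set.mem_ofPred_eq, not_lt] at hlt
    have hR := hS hz
    simp only [R, Set.mem_ofPred_eq] at hR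
    have h1 := le_abs_self z.re
    have h2 := abs_nonneg (z.im / Real.sqrt 2)
    have h3 : |z.im / Real.sqrt 2| = 0 := by linarith
    have h4 : z.im = 0 := by
      have := abs_eq_zero.1 h3
      simpa [sqrt2_pos.ne'] using this
    have h5 : z.re = 3 := by linarith
    have : z = 3 := Complex.ext (by simpa using h5) (by simpa using h4)
    exact hn (this ▸ hz)
  have := convexHull_min hsub (convex_halfSpace_re_lt 3) h
  simp at this

lemma exists_off_axis {S : Set ℂ} (h : (interior (convexHull ℝ S)).Nonempty) :
    ∃ z ∈ S, z.im ≠ 0 := by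
  by_contra! hn
  obtain ⟨w, hw⟩ := h
  have h1 : convexHull ℝ S ⊆ {z : ℂ | z.im ≤ 0} :=
    convexHull_min (fun z hz => (hn z hz).le) (convex_halfSpace_im_le 0)
  have h2 : convexHull ℝ S ⊆ {z : ℂ | 0 ≤ z.im} :=
    convexHull_min (fun z hz => (hn z hz).ge) (convex_halfSpace_im_ge 0)
  have h3 := interior_mono h1 hw
  have h4 := interior_mono h2 hw
  rw [Complex.interior_setOfPred_im_le] at h3
  rw [Complex.interior_setOfPred_le_im] at h4
  simp only [Set.mem_ofPred_eq] at h3 h4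
  linarith

lemma key {A B : Set ℂ} (hA : Good A) (hB : Good B) (hA3 : A ⊆ R → (3 : ℂ) ∉ A)
    (hB3 : B ⊆ R → (3 : ℂ) ∉ B) (hR : A + B ⊆ R) : (3 : ℂ) ∉ A + B := by
  intro h3
  have hAR : A ⊆ R := fun x hx => hR ⟨x, hx, 0, hB.zero_mem, by simp⟩
  have hBR : B ⊆ R := fun x hx => hR ⟨0, hA.zero_mem, x, hx, by simp⟩
  replace hA3 := hA3 hAR
  replace hB3 := hB3 hBR
  obtain ⟨⟨S, hS, rfl⟩, hiA, -⟩ := hA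
  obtain ⟨⟨S', hS', rfl⟩, -⟩ := hB
  rw [← convexHull_add] at h3 hR
  have hSS := (subset_convexHull ℝ _).trans hR
  obtain ⟨a, ha, b, hb, hab⟩ := extreme hSS h3
  obtain ⟨w, hw, hw0⟩ := exists_off_axis hiA
  have haA := subset_convexHull ℝ _ ha
  have hbB := subset_convexHull ℝ _ hb
  have hwA := subset_convexHull ℝ _ hw
  have hwb := hSS ⟨w, hw, b, hb, rfl⟩
  obtain ⟨k, m, rfl⟩ := hS ha
  obtain ⟨k', m', rfl⟩ := hS' hb
  obtain ⟨p, q, rfl⟩ := hS hw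
  have e1 : k + k' = 3 := by
    have := congrArg Complex.re hab
    simp at this
    apply Int.cast_injective (α := ℝ)
    push_cast
    exact this
  have hp := sqrt2_pos.ne'
  have e2 : m + m' = 0 := by
    have := congrArg Complex.im hab
    simp [← add_mul, hp] at this
    exact_mod_cast this
  have hq : q ≠ 0 := by
    rintro rfl
    simp at hw0
  have i1 := R_int (hAR haA)
  have i2 := R_int (hBR hbB)
  have i3 := R_int (hAR hwA)
  have i4 : |p + k'| + 3 * |q + m'| ≤ 3 := by
    apply R_int
    convert hwb using 1
    push_cast
    ring
  have hm : m = 0 := by grind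
  have hm' : m' = 0 := by omega
  subst hm hm'
  have hk : k ≠ 3 := by
    rintro rfl
    exact hA3 (by simpa using haA)
  have hk' : k' ≠ 3 := by
    rintro rfl
    exact hB3 (by simpa using hbB)
  simp only [add_zero, abs_zero, mul_zero] at i1 i2 i3 i4
  have hq1 : 1 ≤ |q| := Int.one_le_abs hq
  have hp0 : p = 0 := by
    apply abs_eq_zero.1
    have := abs_nonneg p
    omega
  subst hp0
  rw [zero_add] at i4
  have h5 := le_abs_self k'
  have h6 := le_abs_self k
  have h7 := abs_nonneg k'
  have h8 : k' = 0 := abs_eq_zero.1 (by omega)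
  omega

lemma P_sub_R : convexHull ℝ ({3, Complex.I * (Real.sqrt 2 : ℂ), -3,
    -(Complex.I * (Real.sqrt 2 : ℂ))} : Set ℂ) ⊆ R := by
  have hp := sqrt2_pos.ne'
  refine convexHull_min ?_ convex_R
  intro z hz
  simp only [Set.mem_insert_iff, Set.mem_singleton_iff] at hz
  rcases hz with rfl | rfl | rfl | rfl <;> simp [R, hp]

/-- The invariant family. -/
def TT : Set (Set ℂ) := {C | (C = ∅ ∨ C = {0} ∨ Good C) ∧ (C ⊆ R → (3 : ℂ) ∉ C)}

lemma gen_sub : genSemiring {C : Set ℂ | ∃ h ∈ OO, C = h • convexHull ℝ ({1,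
    Complex.I * (Real.sqrt 2 : ℂ), -1, -(Complex.I * (Real.sqrt 2 : ℂ))} : Set ℂ)} ⊆ TT := by
  apply Set.sInter_subset_of_mem
  refine ⟨?_, ⟨Or.inl rfl, by simp⟩, ⟨Or.inr (Or.inl rfl), by simp⟩, ?_, ?_⟩
  · rintro _ ⟨h, hh, rfl⟩
    have hD := good_four 1 le_rfl
    simp only [Int.cast_one] at hD
    by_cases h0 : h = 0
    · subst h0
      rw [Set.zero_smul_set ⟨0, hD.zero_mem⟩]
      exact ⟨Or.inr (Or.inl rfl), by simp⟩
    refine ⟨Or.inr (Or.inr (hD.smul hh h0)), fun hsub h3 => ?_⟩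
    have hmem : ∀ z ∈ ({1, Complex.I * (Real.sqrt 2 : ℂ), -1,
        -(Complex.I * (Real.sqrt 2 : ℂ))} : Set ℂ), h * z ∈ R := fun z hz =>
      hsub ⟨z, subset_convexHull ℝ _ hz, rfl⟩
    have himg : h • convexHull ℝ ({1, Complex.I * (Real.sqrt 2 : ℂ), -1,
        -(Complex.I * (Real.sqrt 2 : ℂ))} : Set ℂ) = convexHull ℝ (h • ({1,
        Complex.I * (Real.sqrt 2 : ℂ), -1, -(Complex.I * (Real.sqrt 2 : ℂ))} : Set ℂ)) :=
      LinearMap.image_convexHull (LinearMap.mulLeft ℝ h) _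
    rw [himg] at h3
    obtain ⟨z, hz, hz3⟩ := extreme (by rintro _ ⟨z, hz, rfl⟩; exact hmem z hz) h3
    have m1 := hmem 1 (by simp)
    have m2 := hmem (Complex.I * (Real.sqrt 2 : ℂ)) (by simp)
    obtain ⟨a, b, rfl⟩ := hh
    have i1 : |a| + 3 * |b| ≤ 3 := R_int (by simpa using m1)
    have i2 : |-2 * b| + 3 * |a| ≤ 3 := by
      apply R_int
      convert m2 using 1
      push_cast
      linear_combination -(b : ℂ) * s2_sq
    have ha : |a| ≤ 1 := by grind
    have hb : |b| ≤ 1 := by grind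
    simp only [smul_eq_mul] at hz3
    have hre := congrArg Complex.re hz3
    have hsq : Real.sqrt 2 * Real.sqrt 2 = 2 := Real.mul_self_sqrt (by norm_num)
    simp only [Set.mem_insert_iff, Set.mem_singleton_iff] at hz
    rcases hz with rfl | rfl | rfl | rfl
    · simp at hre
      have : a = 3 := by
        apply Int.cast_injective (α := ℝ)
        push_cast
        exact hre
      grind
    · simp [mul_assoc, hsq] at hre
      have : -(b * 2) = 3 := by
        apply Int.cast_injective (α := ℝ)
        push_cast
        exact hre
      omega
    · simp at hre
      have : -a = 3 := by
        apply Int.cast_injective (α := ℝ)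
        push_cast
        exact hre
      grind
    · simp [mul_assoc, hsq] at hre
      have : b * 2 = 3 := by
        apply Int.cast_injective (α := ℝ)
        push_cast
        exact hre
      omega
  · rintro A ⟨hA, hA3⟩ B ⟨hB, hB3⟩
    refine ⟨?_, fun hsub h3 => ?_⟩
    · rcases hA with rfl | rfl | hA
      · rcases hB with rfl | rfl | hB
        · simp
        · simp
        · rw [Set.empty_union, hB.convex.convexHull_eq]; exact Or.inr (Or.inr hB)
      · rcases hB with rfl | rfl | hB
        · simp
        · simp
        · rw [Set.union_eq_right.2 (by simpa using hB.zero_mem), hB.convex.convexHull_eq]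
          exact Or.inr (Or.inr hB)
      · rcases hB with rfl | rfl | hB
        · rw [Set.union_empty, hA.convex.convexHull_eq]; exact Or.inr (Or.inr hA)
        · rw [Set.union_eq_left.2 (by simpa using hA.zero_mem), hA.convex.convexHull_eq]
          exact Or.inr (Or.inr hA)
        · exact Or.inr (Or.inr (hA.hull hB))
    · have hAB := (subset_convexHull ℝ _).trans hsub
      rcases extreme hAB h3 with h | h
      · exact hA3 (Set.subset_union_left.trans hAB) h
      · exact hB3 (Set.subset_union_right.trans hAB) h
  · rintro A ⟨hA, hA3⟩ B ⟨hB, hB3⟩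
    rcases hA with rfl | rfl | hA
    · rw [Set.empty_add]; exact ⟨Or.inl rfl, by simp⟩
    · rw [Set.singleton_zero, zero_add]; exact ⟨hB, hB3⟩
    · rcases hB with rfl | rfl | hB
      · rw [Set.add_empty]; exact ⟨Or.inl rfl, by simp⟩
      · rw [Set.singleton_zero, add_zero]; exact ⟨Or.inr (Or.inr hA), hA3⟩
      · exact ⟨Or.inr (Or.inr (hA.add hB)), key hA hB hA3 hB3⟩

/-- for `K = ℚ(i√2)`, with `D_K = Conv{1, i√2, -1, -i√2}`, the polygon
`P = Conv{3, i√2, -3, -i√2}` belongs to `𝒞~_{𝒪_K}` but not to the sub-semiring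
`𝒞_{𝒪_K}` generated by `{h·D_K : h ∈ 𝒪_K}`; hence `𝒞_{𝒪_K} ⊊ 𝒞~_{𝒪_K}`. -/
theorem stmt11 (s2 : ℂ) (hs2 : s2 = Complex.I * Real.sqrt 2)
    (O : Set ℂ) (hO : O = {z : ℂ | ∃ a b : ℤ, z = (a : ℂ) + (b : ℂ) * s2})
    (CT : Set (Set ℂ))
    (hCT : CT = {C : Set ℂ | C = ∅ ∨ C = {0} ∨
      ((∃ S : Finset ℂ, (↑S : Set ℂ) ⊆ O ∧ C = convexHull ℝ ↑S) ∧
        (interior C).Nonempty ∧ C = -C)})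
    (D P : Set ℂ)
    (hD : D = convexHull ℝ ({1, s2, -1, -s2} : Set ℂ))
    (hP : P = convexHull ℝ ({3, s2, -3, -s2} : Set ℂ))
    (COK : Set (Set ℂ)) (hCOK : COK = genSemiring {C : Set ℂ | ∃ h ∈ O, C = h • D}) :
    P ∈ CT ∧ P ∉ COK ∧ COK ⊂ CT := by
  subst hs2 hO hCT hD hP hCOK
  have hg := good_four 3 (by norm_num)
  simp only [Int.cast_ofNat] at hg
  have hP3 := subset_convexHull ℝ ({3, Complex.I * (Real.sqrt 2 : ℂ), -3,
    -(Complex.I * (Real.sqrt 2 : ℂ))} : Set ℂ) (Set.mem_insert _ _)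
  refine ⟨Or.inr (Or.inr hg), fun h => (gen_sub h).2 P_sub_R hP3, fun C hC => (gen_sub hC).1, ?_⟩
  intro h
  exact (gen_sub (h (Or.inr (Or.inr hg)))).2 P_sub_R hP3
end

section
/- Let $K$ be an imaginary quadratic field with class number 1 and let $\mathcal{S}_{mod}$ be the set of sub-semirings of $\mathcal{C}_{K,\mathbb{C}}$ of the form $\mathrm{Semiring}\{h D_K : h \in H\}$ for $H$ a sub-$\mathcal{O}_K$-module of $K$. The map $\Phi(a, \lambda) := \mathrm{Semiring}\{h \lambda D_K : h \in H_a\}$ from $(\mathbb{A}^f_K/\widetilde{\mathcal{O}_K}^\star) \times (\mathbb{C}/\mathcal{U}_K)$ to $\mathcal{S}_{mod}$ is invariant under the diagonal action of $K^\star$ and induces a bijection from the quotient by this action onto $\mathcal{S}_{mod}$. -/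
open Pointwise NumberField

/-- Extreme points of `A` lie in Minkowski sums of generators contained in `A`. -/
def Dec (D X A : Set ℂ) : Prop :=
  ∀ v ∈ A.extremePoints ℝ, ∃ (J : Type) (_ : Fintype J) (h : J → ℂ), (∀ i, h i ∈ X) ∧
    (∀ x : J → ℂ, (∀ i, x i ∈ D) → ∑ i, h i * x i ∈ A) ∧
    ∃ x : J → ℂ, (∀ i, x i ∈ D) ∧ v = ∑ i, h i * x i

theorem dec_gen (D X : Set ℂ) (A : Set ℂ)
    (hA : A ∈ genSemiring {C : Set ℂ | ∃ h ∈ X, C = h • D}) : Dec D X A := by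
  refine hA {A | Dec D X A} ⟨?_, ?_, ?_, ?_, ?_⟩
  · rintro C ⟨h, hX, rfl⟩ v hv
    obtain ⟨y, hy, rfl⟩ := hv.1
    refine ⟨Unit, inferInstance, fun _ => h, fun _ => hX, ?_, fun _ => y, fun _ => hy, by simp⟩
    intro x hx
    exact ⟨x (), hx (), by simp⟩
  · intro v hv
    exact absurd hv.1 (by simp)
  · intro v hv
    refine ⟨Empty, inferInstance, fun _ => 0, fun i => i.elim, by simp, fun _ => 0,
      fun i => i.elim, ?_⟩
    simpa using hv.1
  · intro A hA B hB v hv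
    have hsub : A ∪ B ⊆ convexHull ℝ (A ∪ B) := subset_convexHull ℝ _
    rcases extremePoints_convexHull_subset hv with h | h
    · obtain ⟨J, i1, h', h1, h2, h3⟩ := hA v
        (inter_extremePoints_subset_extremePoints_of_subset (Set.subset_union_left.trans hsub) ⟨h, hv⟩)
      exact ⟨J, i1, h', h1, fun x hx => hsub (Or.inl (h2 x hx)), h3⟩
    · obtain ⟨J, i1, h', h1, h2, h3⟩ := hB v
        (inter_extremePoints_subset_extremePoints_of_subset (Set.subset_union_right.trans hsub) ⟨h, hv⟩)
      exact ⟨J, i1, h', h1, fun x hx => hsub (Or.inr (h2 x hx)), h3⟩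
  · intro A hA B hB v hv
    obtain ⟨a, ha, b, hb, rfl⟩ := hv.1
    have hae : a ∈ A.extremePoints ℝ := by
      refine ⟨ha, fun p hp q hq hpq => ?_⟩
      have := hv.2 (Set.add_mem_add hp hb) (Set.add_mem_add hq hb) (by
        have := (mem_openSegment_translate ℝ b).2 hpq
        simpa [add_comm] using this)
      simpa using this
    have hbe : b ∈ B.extremePoints ℝ := by
      refine ⟨hb, fun p hp q hq hpq => ?_⟩
      have := hv.2 (Set.add_mem_add ha hp) (Set.add_mem_add ha hq) (by
        have := (mem_openSegment_translate ℝ a).2 hpq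
        simpa [add_comm] using this)
      simpa using this
    obtain ⟨J, i1, h, h1, h2, x, h3, h4⟩ := hA a hae
    obtain ⟨J', i1', h', h1', h2', x', h3', h4'⟩ := hB b hbe
    refine ⟨J ⊕ J', inferInstance, Sum.elim h h', ?_, ?_, Sum.elim x x', ?_, ?_⟩
    · rintro (i | i) <;> simp [h1, h1']
    · intro y hy
      rw [Fintype.sum_sum_type]
      exact Set.add_mem_add (h2 (fun i => y (Sum.inl i)) fun i => hy _)
        (h2' (fun i => y (Sum.inr i)) fun i => hy _)
    · rintro (i | i) <;> simp [h3, h3']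
    · simp [Fintype.sum_sum_type, h4, h4']

/-- A point of maximal norm in a convex hull belongs to the set. -/
theorem mem_of_max_norm (v : ℂ) (B : Set ℂ) (hv : v ∈ B)
    (hB : ∀ x ∈ B, ‖x‖ ≤ ‖v‖) : v ∈ B.extremePoints ℝ := by
  refine inter_extremePoints_subset_extremePoints_of_subset
    (A := Metric.closedBall (0:ℂ) ‖v‖) (B := B) (fun x hx => by simpa using hB x hx) ⟨hv, ?_⟩
  rw [mem_extremePoints_iff_left]
  refine ⟨by simp, fun x hx y hy hxy => ?_⟩
  by_contra hne
  have hxy' : x ≠ y := by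
    rintro rfl
    simp at hxy
    exact hne hxy.symm
  have := (strictConvex_closedBall ℝ (0:ℂ) ‖v‖).openSegment_subset hx hy hxy' hxy
  by_cases h0 : ‖v‖ = 0
  · rw [h0] at hx hy; simp at hx hy; exact hxy' (hx.trans hy.symm)
  · rw [interior_closedBall _ h0] at this
    simp at this

theorem circ_int (F : ℂ → ℝ) (u : ℂ) (hu : ‖u‖ = 1) :
    ∫ θ in (0:ℝ)..(2*Real.pi), F (Complex.exp (θ * Complex.I) * u) =
    ∫ θ in (0:ℝ)..(2*Real.pi), F (Complex.exp (θ * Complex.I)) := by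
  have hu' : u = Complex.exp (u.arg * Complex.I) := by
    conv_lhs => rw [← Complex.norm_mul_exp_arg_mul_I u, hu]
    simp
  have hp : Function.Periodic (fun θ : ℝ => F (Complex.exp (θ * Complex.I))) (2*Real.pi) := by
    intro θ
    have := Complex.exp_periodic (θ * Complex.I)
    simp only
    congr 1
    rw [← this]; congr 1; push_cast; ring
  have h := hp.intervalIntegral_add_eq u.arg 0
  rw [zero_add] at h
  rw [← h]
  have := intervalIntegral.integral_comp_add_right (a := 0) (b := 2*Real.pi)
    (fun θ : ℝ => F (Complex.exp (θ * Complex.I))) u.arg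
  rw [zero_add, add_comm (2*Real.pi)] at this
  rw [← this]
  congr 1
  ext θ
  congr 1
  conv_lhs => rw [hu']
  rw [← Complex.exp_add]; congr 1; push_cast; ring

theorem circ_zero (F : ℂ → ℝ) (hF : Continuous F) (h0 : ∀ z, 0 ≤ F z)
    (hi : ∫ θ in (0:ℝ)..(2*Real.pi), F (Complex.exp (θ * Complex.I)) ≤ 0) (u : ℂ) (hu : ‖u‖ = 1) :
    F u = 0 := by
  by_contra hne
  have hpos : 0 < F u := lt_of_le_of_ne (h0 u) (Ne.symm hne)
  have hi' := circ_int F u hu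
  have : 0 < ∫ θ in (0:ℝ)..(2*Real.pi), F (Complex.exp (θ * Complex.I) * u) := by
    refine intervalIntegral.integral_pos (by positivity) ?_ (fun _ _ => h0 _)
      ⟨0, ⟨le_rfl, by positivity⟩, by simpa using hpos⟩
    exact (by fun_prop : Continuous _).continuousOn
  linarith

theorem core (f : ℂ → ℝ) (hf : Continuous f) (hhom : ∀ (r : ℝ) z, 0 ≤ r → f (r * z) = r * f z)
    (hI : 0 < ∫ θ in (0:ℝ)..(2*Real.pi), f (Complex.exp (θ * Complex.I)))
    {J : Type} [Fintype J] (h : J → ℂ) (m : ℂ)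
    (hle : ∀ z, ∑ i, f (z * h i) ≤ f (z * m)) (hm : ‖m‖ ≤ ∑ i, ‖h i‖) :
    ∑ i, ‖h i‖ = ‖m‖ ∧ ∀ i, ∀ z, ‖z‖ = 1 → ‖m‖ * f (z * h i) = ‖h i‖ * f (z * m) := by
  set I := ∫ θ in (0:ℝ)..(2*Real.pi), f (Complex.exp (θ * Complex.I)) with hIdef
  set Q := ∫ θ in (0:ℝ)..(2*Real.pi), f (Complex.exp (θ * Complex.I)) ^ 2 with hQdef
  have ii : ∀ F : ℂ → ℝ, Continuous F → IntervalIntegrable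
      (fun θ : ℝ => F (Complex.exp (θ * Complex.I))) MeasureTheory.volume 0 (2*Real.pi) :=
    fun F hF => (by fun_prop : Continuous _).intervalIntegrable _ _
  have hpol : ∀ c : ℂ, ∃ u : ℂ, ‖u‖ = 1 ∧ c = ‖c‖ * u := fun c =>
    ⟨Complex.exp (c.arg * Complex.I), by simp [Complex.norm_exp_ofReal_mul_I], by simp⟩
  have e : ∀ (c _z : ℂ), ∃ u : ℂ, ‖u‖ = 1 ∧ ∀ z, f (z * c) = ‖c‖ * f (z * u) := by
    intro c _
    obtain ⟨u, hu, hc⟩ := hpol c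
    refine ⟨u, hu, fun z => ?_⟩
    rw [← hhom _ _ (norm_nonneg c)]
    congr 1
    conv_lhs => rw [hc]
    ring
  have i1 : ∀ c : ℂ, ∫ θ in (0:ℝ)..(2*Real.pi), f (Complex.exp (θ * Complex.I) * c) = ‖c‖ * I := by
    intro c
    obtain ⟨u, hu, hc⟩ := e c 0
    simp_rw [hc]
    rw [intervalIntegral.integral_const_mul, circ_int f u hu]
  have i2 : ∀ c : ℂ, ∫ θ in (0:ℝ)..(2*Real.pi), f (Complex.exp (θ * Complex.I) * c) ^ 2
      = ‖c‖ ^ 2 * Q := by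
    intro c
    obtain ⟨u, hu, hc⟩ := e c 0
    simp_rw [hc, mul_pow]
    rw [intervalIntegral.integral_const_mul, circ_int (fun z => f z ^ 2) u hu]
  have isum : ∫ θ in (0:ℝ)..(2*Real.pi), (f (Complex.exp (θ * Complex.I) * m) -
      ∑ i, f (Complex.exp (θ * Complex.I) * h i)) = ‖m‖ * I - (∑ i, ‖h i‖) * I := by
    rw [intervalIntegral.integral_sub (ii (fun z => f (z * m)) (by fun_prop))
      (ii (fun z => ∑ i, f (z * h i)) (by fun_prop)), i1,
      intervalIntegral.integral_finsetSum (fun i _ => ii (fun z => f (z * h i)) (by fun_prop))]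
    simp_rw [i1]
    rw [Finset.sum_mul]
  have hpos : 0 ≤ ∫ θ in (0:ℝ)..(2*Real.pi), (f (Complex.exp (θ * Complex.I) * m) -
      ∑ i, f (Complex.exp (θ * Complex.I) * h i)) :=
    intervalIntegral.integral_nonneg (by positivity) (fun θ _ => by
      linarith [hle (Complex.exp (θ * Complex.I))])
  have hsum : ∑ i, ‖h i‖ = ‖m‖ := by
    rw [isum] at hpos
    nlinarith
  refine ⟨hsum, ?_⟩
  have hpt : ∀ z, ‖z‖ = 1 → f (z * m) = ∑ i, f (z * h i) := by
    intro z hz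
    have := circ_zero (fun z => f (z * m) - ∑ i, f (z * h i)) (by fun_prop)
      (fun z => by linarith [hle z]) (by rw [isum, hsum]; simp) z hz
    linarith
  have sq : ∀ i, ∫ θ in (0:ℝ)..(2*Real.pi), (‖m‖ * f (Complex.exp (θ * Complex.I) * h i) -
      ‖h i‖ * f (Complex.exp (θ * Complex.I) * m)) ^ 2 = 2 * ‖m‖ * ‖h i‖ * (‖m‖ * ‖h i‖ * Q -
      ∫ θ in (0:ℝ)..(2*Real.pi), f (Complex.exp (θ * Complex.I) * h i) *
        f (Complex.exp (θ * Complex.I) * m)) := by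
    intro i
    have : ∀ θ : ℝ, (‖m‖ * f (Complex.exp (θ * Complex.I) * h i) -
      ‖h i‖ * f (Complex.exp (θ * Complex.I) * m)) ^ 2 =
      (‖m‖ ^ 2 * f (Complex.exp (θ * Complex.I) * h i) ^ 2 +
      ‖h i‖ ^ 2 * f (Complex.exp (θ * Complex.I) * m) ^ 2) -
      2 * ‖m‖ * ‖h i‖ * (f (Complex.exp (θ * Complex.I) * h i) *
        f (Complex.exp (θ * Complex.I) * m)) := by intro θ; ring
    simp_rw [this]
    rw [intervalIntegral.integral_sub (ii (fun z => ‖m‖ ^ 2 * f (z * h i) ^ 2 +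
        ‖h i‖ ^ 2 * f (z * m) ^ 2) (by fun_prop))
        (ii (fun z => 2 * ‖m‖ * ‖h i‖ * (f (z * h i) * f (z * m))) (by fun_prop)),
      intervalIntegral.integral_add (ii (fun z => ‖m‖ ^ 2 * f (z * h i) ^ 2) (by fun_prop))
        (ii (fun z => ‖h i‖ ^ 2 * f (z * m) ^ 2) (by fun_prop))]
    simp only [intervalIntegral.integral_const_mul, i2]
    ring
  have hle2 : ∀ i ∈ Finset.univ, ∫ θ in (0:ℝ)..(2*Real.pi), f (Complex.exp (θ * Complex.I) * h i) *
        f (Complex.exp (θ * Complex.I) * m) ≤ ‖m‖ * ‖h i‖ * Q := by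
    intro i _
    by_cases hi : h i = 0
    · have f0 : f 0 = 0 := by simpa using hhom 0 0 le_rfl
      simp [hi, f0]
    by_cases hm0 : m = 0
    · have f0 : f 0 = 0 := by simpa using hhom 0 0 le_rfl
      simp [hm0, f0]
    have h1 : 0 < 2 * ‖m‖ * ‖h i‖ := by positivity
    have h2 := sq i
    have h3 : 0 ≤ ∫ θ in (0:ℝ)..(2*Real.pi), (‖m‖ * f (Complex.exp (θ * Complex.I) * h i) -
      ‖h i‖ * f (Complex.exp (θ * Complex.I) * m)) ^ 2 :=
      intervalIntegral.integral_nonneg (by positivity) (fun θ _ => sq_nonneg _)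
    rw [h2] at h3
    have := nonneg_of_mul_nonneg_right h3 h1
    linarith
  have hS : ∑ i, ∫ θ in (0:ℝ)..(2*Real.pi), f (Complex.exp (θ * Complex.I) * h i) *
        f (Complex.exp (θ * Complex.I) * m) = ∑ i, ‖m‖ * ‖h i‖ * Q := by
    rw [← intervalIntegral.integral_finsetSum
      (fun i _ => ii (fun z => f (z * h i) * f (z * m)) (by fun_prop))]
    have : ∀ θ : ℝ, ∑ i, f (Complex.exp (θ * Complex.I) * h i) *
        f (Complex.exp (θ * Complex.I) * m) = f (Complex.exp (θ * Complex.I) * m) ^ 2 := by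
      intro θ
      rw [← Finset.sum_mul, ← hpt _ (Complex.norm_exp_ofReal_mul_I θ)]
      ring
    simp_rw [this]
    rw [i2, ← Finset.sum_mul, ← Finset.mul_sum, hsum]; ring
  have heq := (Finset.sum_eq_sum_iff_of_le hle2).1 hS
  intro i z hz
  have := circ_zero (fun z => (‖m‖ * f (z * h i) - ‖h i‖ * f (z * m)) ^ 2) (by fun_prop)
    (fun z => sq_nonneg _) (by rw [sq i, heq i (Finset.mem_univ i)]; simp) z hz
  simp only [sq_eq_zero_iff] at this
  linarith

/-- Support function of the convex hull of `S`. -/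
noncomputable def sf (S : Finset ℂ) (hS : S.Nonempty) (z : ℂ) : ℝ :=
  S.sup' hS (fun s => (z * s).re)

theorem sf_cont (S : Finset ℂ) (hS : S.Nonempty) : Continuous (sf S hS) := by
  unfold sf
  exact Continuous.finset_sup'_apply hS (fun s _ => by fun_prop)

theorem sf_ge (S : Finset ℂ) (hS : S.Nonempty) (z x : ℂ) (hx : x ∈ convexHull ℝ (S : Set ℂ)) :
    (z * x).re ≤ sf S hS z := by
  have hconv : Convex ℝ {x : ℂ | (z * x).re ≤ sf S hS z} := by
    intro a ha b hb p q hp hq hpq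
    simp only [Set.mem_ofPred_eq] at ha hb ⊢
    have : (z * (p • a + q • b)).re = p * (z * a).re + q * (z * b).re := by
      simp; ring
    rw [this]
    calc _ ≤ p * sf S hS z + q * sf S hS z := by gcongr
      _ = _ := by rw [← add_mul, hpq, one_mul]
  exact convexHull_min (fun s hs => Finset.le_sup' (fun s => (z * s).re) hs) hconv hx

theorem sf_attain (S : Finset ℂ) (hS : S.Nonempty) (z : ℂ) :
    ∃ x ∈ convexHull ℝ (S : Set ℂ), (z * x).re = sf S hS z := by
  obtain ⟨s, hs, h⟩ := Finset.exists_mem_eq_sup' hS (fun s => (z * s).re)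
  exact ⟨s, subset_convexHull ℝ _ hs, h.symm⟩

theorem sf_hom (S : Finset ℂ) (hS : S.Nonempty) (r : ℝ) (z : ℂ) (hr : 0 ≤ r) :
    sf S hS (r * z) = r * sf S hS z := by
  apply le_antisymm
  · obtain ⟨x, hx, h⟩ := sf_attain S hS (r * z)
    rw [← h, mul_assoc, Complex.re_ofReal_mul]
    exact mul_le_mul_of_nonneg_left (sf_ge S hS z x hx) hr
  · obtain ⟨x, hx, h⟩ := sf_attain S hS z
    rw [← h, ← Complex.re_ofReal_mul, ← mul_assoc]
    exact sf_ge S hS _ x hx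

theorem mem_of_sf (S : Finset ℂ) (hS : S.Nonempty) (x : ℂ)
    (h : ∀ z, ‖z‖ = 1 → (z * x).re ≤ sf S hS z) : x ∈ convexHull ℝ (S : Set ℂ) := by
  by_contra hx
  have hcl : IsClosed (convexHull ℝ (S : Set ℂ)) := S.finite_toSet.isClosed_convexHull ℝ
  obtain ⟨L, c, h1, h2⟩ := geometric_hahn_banach_closed_point (convex_convexHull ℝ _) hcl hx
  set z : ℂ := L 1 - Complex.I * L Complex.I with hz
  have hL : ∀ y : ℂ, L y = (z * y).re := by
    intro y
    have : y = y.re • (1:ℂ) + y.im • Complex.I := by simp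
    conv_lhs => rw [this]
    rw [map_add, map_smul, map_smul]
    simp [hz]; ring
  have hlt : sf S hS z < (z * x).re := by
    obtain ⟨y, hy, he⟩ := sf_attain S hS z
    rw [← he, ← hL, ← hL]
    exact (h1 y hy).trans h2
  have hz0 : z ≠ 0 := by
    intro h0
    obtain ⟨y, hy, he⟩ := sf_attain S hS z
    rw [← he, h0] at hlt
    simp at hlt
  have hn : 0 < ‖z‖ := norm_pos_iff.2 hz0
  have hnc : (‖z‖ : ℂ) ≠ 0 := by exact_mod_cast hn.ne'
  have := h ((‖z‖ : ℂ)⁻¹ * z) (by simp [hn.ne'])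
  have hzz : z = (‖z‖ : ℝ) * ((‖z‖ : ℂ)⁻¹ * z) := by field_simp
  have e1 : sf S hS z = ‖z‖ * sf S hS ((‖z‖ : ℂ)⁻¹ * z) := by
    conv_lhs => rw [hzz]
    exact sf_hom S hS _ _ hn.le
  have e2 : (z * x).re = ‖z‖ * ((‖z‖ : ℂ)⁻¹ * z * x).re := by
    rw [← Complex.re_ofReal_mul]
    congr 1
    field_simp
  rw [e1, e2] at hlt
  exact absurd (mul_le_mul_of_nonneg_left this hn.le) (not_le.2 hlt)

theorem smul_eq_of_sf (S : Finset ℂ) (hS : S.Nonempty) (p : ℂ) (hp : ‖p‖ = 1)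
    (h : ∀ z, ‖z‖ = 1 → sf S hS (z * p) = sf S hS z) :
    p • convexHull ℝ (S : Set ℂ) = convexHull ℝ (S : Set ℂ) := by
  have hp0 : p ≠ 0 := by rintro rfl; simp at hp
  apply Set.Subset.antisymm
  · rintro _ ⟨x, hx, rfl⟩
    apply mem_of_sf S hS
    intro z hz
    rw [← h z hz]
    have := sf_ge S hS (z * p) x hx
    simpa [mul_assoc] using this
  · intro x hx
    rw [Set.mem_smul_set_iff_inv_smul_mem₀ hp0]
    apply mem_of_sf S hS
    intro z hz
    have h2 := h (z * p⁻¹) (by simp [hz, hp])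
    rw [mul_assoc, inv_mul_cancel₀ hp0, mul_one] at h2
    rw [h2]
    have := sf_ge S hS (z * p⁻¹) x hx
    simpa [mul_assoc] using this

theorem sf_int (S : Finset ℂ) (hS : S.Nonempty)
    (hint : (interior (convexHull ℝ (S : Set ℂ))).Nonempty) :
    0 < ∫ θ in (0:ℝ)..(2*Real.pi), sf S hS (Complex.exp (θ * Complex.I)) := by
  obtain ⟨c, hc⟩ := hint
  obtain ⟨r, hr, hb⟩ := Metric.isOpen_iff.1 isOpen_interior c hc
  have hcont := sf_cont S hS
  have hlow : ∀ θ : ℝ, (Complex.exp (θ * Complex.I) * c).re + r / 2 ≤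
      sf S hS (Complex.exp (θ * Complex.I)) := by
    intro θ
    have hm : c + (r / 2 : ℝ) * Complex.exp (-(θ * Complex.I)) ∈ convexHull ℝ (S : Set ℂ) := by
      apply interior_subset
      apply hb
      have : ‖Complex.exp (-(θ * Complex.I))‖ = 1 := by
        have := Complex.norm_exp_ofReal_mul_I (-θ)
        simpa using this
      rw [Metric.mem_ball, dist_eq_norm, add_sub_cancel_left, norm_mul, this, Complex.norm_real]
      rw [Real.norm_of_nonneg (by positivity)]
      linarith
    have := sf_ge S hS (Complex.exp (θ * Complex.I)) _ hm
    refine le_trans (le_of_eq ?_) this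
    rw [mul_add, Complex.add_re, mul_left_comm, ← Complex.exp_add]
    simp
  have hz : ∫ θ in (0:ℝ)..(2*Real.pi), (Complex.exp (θ * Complex.I) * c).re = 0 := by
    have h1 := circ_int (fun z => (z * c).re) (-1) (by simp)
    simp only [mul_neg, mul_one, neg_mul, Complex.neg_re] at h1
    rw [intervalIntegral.integral_neg] at h1
    linarith
  have h2 : ∫ θ in (0:ℝ)..(2*Real.pi), ((Complex.exp (θ * Complex.I) * c).re + r / 2) =
      2 * Real.pi * (r / 2) := by
    rw [intervalIntegral.integral_add ((by fun_prop : Continuous _).intervalIntegrable _ _)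
      ((by fun_prop : Continuous _).intervalIntegrable _ _), hz]
    simp
    ring
  have h3 : ∫ θ in (0:ℝ)..(2*Real.pi), ((Complex.exp (θ * Complex.I) * c).re + r / 2) ≤
      ∫ θ in (0:ℝ)..(2*Real.pi), sf S hS (Complex.exp (θ * Complex.I)) :=
    intervalIntegral.integral_mono_on (by positivity)
      ((by fun_prop : Continuous _).intervalIntegrable _ _)
      ((by fun_prop : Continuous _).intervalIntegrable _ _) (fun θ _ => hlow θ)
  have : 0 < 2 * Real.pi * (r / 2) := by positivity
  linarith

theorem exists_max (S : Finset ℂ)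
    (hint : (interior (convexHull ℝ (S : Set ℂ))).Nonempty) :
    ∃ v ∈ convexHull ℝ (S : Set ℂ), v ≠ 0 ∧ ∀ x ∈ convexHull ℝ (S : Set ℂ), ‖x‖ ≤ ‖v‖ := by
  have hcp : IsCompact (convexHull ℝ (S : Set ℂ)) := S.finite_toSet.isCompact_convexHull ℝ
  obtain ⟨v, hv, hmax⟩ := hcp.exists_isMaxOn (hint.mono interior_subset)
    (continuous_norm.continuousOn)
  refine ⟨v, hv, ?_, fun x hx => hmax hx⟩
  rintro rfl
  have : convexHull ℝ (S : Set ℂ) ⊆ {0} := fun x hx => by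
    have := hmax hx
    simpa using this
  have := interior_mono this
  rw [interior_singleton] at this
  obtain ⟨y, hy⟩ := hint
  exact this hy

theorem stab_norm (S : Finset ℂ)
    (hint : (interior (convexHull ℝ (S : Set ℂ))).Nonempty) (u : ℂˣ)
    (hu : (u : ℂ) • convexHull ℝ (S : Set ℂ) = convexHull ℝ (S : Set ℂ)) :
    ∃ n : ℕ, 0 < n ∧ (u : ℂ) ^ n = 1 := by
  obtain ⟨v, hv, hv0, hmax⟩ := exists_max S hint
  have hvp : 0 < ‖v‖ := norm_pos_iff.2 hv0
  have hmem : ∀ x ∈ convexHull ℝ (S : Set ℂ), (u : ℂ) * x ∈ convexHull ℝ (S : Set ℂ) := by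
    intro x hx
    rw [← hu]; exact Set.smul_mem_smul_set hx
  have h1 : ‖(u : ℂ)‖ = 1 := by
    apply le_antisymm
    · have := hmax _ (hmem v hv)
      rw [norm_mul] at this
      nlinarith
    · rw [← hu] at hv
      obtain ⟨y, hy, hyv⟩ := hv
      have := hmax y hy
      simp only [smul_eq_mul] at hyv
      rw [← hyv, norm_mul] at this hvp
      by_contra hlt
      push Not at hlt
      have hy0 : 0 < ‖y‖ := by
        rcases (norm_nonneg y).eq_or_lt with h | h
        · rw [← h] at hvp; simp at hvp
        · exact h
      nlinarith
  have hpow : ∀ n : ℕ, (u : ℂ) ^ n * v ∈ S := by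
    intro n
    have hm : (u : ℂ) ^ n * v ∈ convexHull ℝ (S : Set ℂ) := by
      induction n with
      | zero => simpa using hv
      | succ k ih =>
        have := hmem _ ih
        rw [pow_succ']
        rwa [mul_assoc]
    exact extremePoints_convexHull_subset
      (mem_of_max_norm _ _ hm (fun x hx => by simpa [h1] using hmax x hx))
  have hninj : ¬ Function.Injective (fun n : ℕ => (⟨(u : ℂ) ^ n * v, hpow n⟩ : S)) :=
    not_injective_infinite_finite _
  simp only [Function.Injective, not_forall] at hninj
  obtain ⟨a, b, hab, hne⟩ := hninj
  simp only [Subtype.mk.injEq] at hab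
  have hab' := mul_right_cancel₀ hv0 hab
  wlog hlt : a < b generalizing a b
  · exact this b a (Ne.symm hne) hab.symm hab'.symm (by omega)
  refine ⟨b - a, by omega, ?_⟩
  have : (u : ℂ) ^ a * (u : ℂ) ^ (b - a) = (u : ℂ) ^ a * 1 := by
    rw [← pow_add, mul_one, hab']; congr 1; omega
  exact mul_left_cancel₀ (pow_ne_zero _ u.ne_zero) this

theorem key_s15 (S : Finset ℂ) (hint : (interior (convexHull ℝ (S : Set ℂ))).Nonempty)
    (X : Set ℂ) (c : ℂ) (hc0 : c ≠ 0)
    (hc : c • convexHull ℝ (S : Set ℂ) ∈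
      genSemiring {C : Set ℂ | ∃ h ∈ X, C = h • convexHull ℝ (S : Set ℂ)}) :
    ∃ (J : Type) (_ : Fintype J) (h : J → ℂ) (u : J → ℂˣ) (t : J → ℝ), (∀ i, h i ∈ X) ∧
      (∀ i, (u i : ℂ) • convexHull ℝ (S : Set ℂ) = convexHull ℝ (S : Set ℂ)) ∧
      (∀ i, 0 ≤ t i) ∧ ∑ i, t i = 1 ∧ ∀ i, h i * u i = t i * c := by
  have hS : S.Nonempty := by
    rw [Finset.nonempty_iff_ne_empty]
    rintro rfl
    simp at hint
  obtain ⟨v, hv, hv0, hmax⟩ := exists_max S hint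
  have hvp : 0 < ‖v‖ := norm_pos_iff.2 hv0
  have hcp : 0 < ‖c‖ := norm_pos_iff.2 hc0
  obtain ⟨J, iJ, h, hX, hin, x, hx, hvx⟩ := dec_gen _ _ _ hc (c * v)
    (mem_of_max_norm _ _ (Set.smul_mem_smul_set hv) (by
      rintro _ ⟨x, hx, rfl⟩
      simp only [smul_eq_mul, norm_mul]
      gcongr
      exact hmax x hx))
  have hle : ∀ z, ∑ i, sf S hS (z * h i) ≤ sf S hS (z * c) := by
    intro z
    choose y hy hye using fun i => sf_attain S hS (z * h i)
    obtain ⟨w, hw, hwe⟩ := hin y hy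
    have := sf_ge S hS (z * c) w hw
    refine le_trans (le_of_eq ?_) this
    simp only [smul_eq_mul] at hwe
    rw [mul_assoc, hwe, Finset.mul_sum, Complex.re_sum]
    refine Finset.sum_congr rfl fun i _ => ?_
    rw [← hye, mul_assoc]
  have hm : ‖c‖ ≤ ∑ i, ‖h i‖ := by
    have : ‖c * v‖ ≤ ∑ i, ‖h i‖ * ‖v‖ := by
      rw [hvx]
      refine (norm_sum_le _ _).trans (Finset.sum_le_sum fun i _ => ?_)
      rw [norm_mul]
      gcongr
      exact hmax _ (hx i)
    rw [← Finset.sum_mul, norm_mul] at this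
    exact le_of_mul_le_mul_right this hvp
  obtain ⟨hs, he⟩ := core (sf S hS) (sf_cont S hS) (sf_hom S hS) (sf_int S hS hint) h c hle hm
  have hu : ∀ i, ∃ u : ℂˣ, (u : ℂ) • convexHull ℝ (S : Set ℂ) = convexHull ℝ (S : Set ℂ) ∧
      h i * u = (‖h i‖ / ‖c‖ : ℝ) * c := by
    intro i
    by_cases hi : h i = 0
    · exact ⟨1, by simp, by simp [hi]⟩
    have hip : 0 < ‖h i‖ := norm_pos_iff.2 hi
    have hic : (‖h i‖ : ℂ) ≠ 0 := by exact_mod_cast hip.ne'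
    have hcc : (‖c‖ : ℂ) ≠ 0 := by exact_mod_cast hcp.ne'
    set p : ℂ := (‖h i‖ / ‖c‖ : ℝ) * c / h i with hpdef
    have hpn : ‖p‖ = 1 := by
      rw [hpdef, norm_div, norm_mul, Complex.norm_real, Real.norm_of_nonneg (by positivity)]
      field_simp
    have hp0 : p ≠ 0 := by rintro h0; rw [h0] at hpn; simp at hpn
    have hmul : h i * p = (‖h i‖ / ‖c‖ : ℝ) * c := by rw [hpdef]; field_simp
    refine ⟨Units.mk0 p hp0, ?_, hmul⟩
    refine smul_eq_of_sf S hS p hpn fun z hz => ?_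
    set z' : ℂ := z * (‖h i‖ : ℂ) / h i with hz'
    have hz'n : ‖z'‖ = 1 := by
      rw [hz', norm_div, norm_mul, hz, Complex.norm_real, norm_norm, one_mul, div_self hip.ne']
    have h1 := he i z' hz'n
    have h2 : z' * h i = (‖h i‖ : ℝ) * z := by rw [hz']; field_simp
    have h3 : z' * c = (‖c‖ : ℝ) * (z * p) := by
      rw [hz', hpdef]; push_cast; field_simp
    rw [h2, h3, sf_hom _ _ _ _ hip.le, sf_hom _ _ _ _ hcp.le] at h1
    have : ‖c‖ * ‖h i‖ * (sf S hS (z * p) - sf S hS z) = 0 := by linarith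
    have h4 : ‖c‖ * ‖h i‖ ≠ 0 := by positivity
    have := (mul_eq_zero.1 this).resolve_left h4
    linarith
  choose u hu1 hu2 using hu
  refine ⟨J, iJ, h, u, fun i => ‖h i‖ / ‖c‖, hX, hu1, fun i => by positivity, ?_, hu2⟩
  rw [← Finset.sum_div, hs, div_self hcp.ne']

/-- Galois argument: positive combinations of roots of unity over `K`. -/
theorem galB {K : Type*} [Field K] [NumberField K] (ι : K →+* ℂ) {J : Type*} [Fintype J]
    (n : K) (hn : n ≠ 0) (k : J → K) (u : J → ℂ) (t : J → ℝ)
    (hu : ∀ i, ∃ m : ℕ, 0 < m ∧ u i ^ m = 1) (ht0 : ∀ i, 0 ≤ t i) (ht : ∑ i, t i = 1)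
    (hk : ∀ i, ι (k i) * u i = t i * ι n) :
    ∀ i, ∃ e : 𝓞 K, ι (k i) * u i = ι ((e : K) * k i) := by
  let _ : Algebra K ℂ := ι.toAlgebra
  have halg : ∀ x : K, algebraMap K ℂ x = ι x := fun _ => rfl
  let L := algebraicClosure K ℂ
  have hnorm : ∀ i, ‖u i‖ = 1 := fun i => by
    obtain ⟨m, hm, h⟩ := hu i
    exact Complex.norm_eq_one_of_pow_eq_one h hm.ne'
  have huL : ∀ i, u i ∈ L := fun i => by
    obtain ⟨m, hm, h⟩ := hu i
    rw [mem_algebraicClosure_iff]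
    refine ⟨Polynomial.X ^ m - 1, Polynomial.X_pow_sub_C_ne_zero hm 1, by simp [h]⟩
  have : IsGalois K L := { }
  have hin : ι n ≠ 0 := by simpa using hn
  intro i
  by_cases hki : k i = 0
  · exact ⟨0, by simp [hki]⟩
  have hfix : ∀ σ : L ≃ₐ[K] L, σ ⟨u i, huL i⟩ = ⟨u i, huL i⟩ := by
    intro σ
    let w : J → ℂ := fun j => (σ ⟨u j, huL j⟩ : L)
    have hw : ∀ j, ‖w j‖ = 1 := fun j => by
      obtain ⟨m, hm, h⟩ := hu j
      refine Complex.norm_eq_one_of_pow_eq_one (n := m) ?_ hm.ne'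
      have : (⟨u j, huL j⟩ : L) ^ m = 1 := Subtype.ext h
      have := congrArg σ this
      rw [map_pow, map_one] at this
      exact congrArg (fun x : L => (x : ℂ)) this
    have hsum : ∑ j, ι (k j) * u j = ι n := by
      simp_rw [hk]
      rw [← Finset.sum_mul, ← Complex.ofReal_sum, ht]; simp
    have hsumL : ∑ j, algebraMap K L (k j) * (⟨u j, huL j⟩ : L) = algebraMap K L n := by
      apply Subtype.ext
      refine Eq.trans ?_ hsum
      push_cast
      rfl
    have hsumw : ∑ j, ι (k j) * w j = ι n := by
      have := congrArg σ hsumL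
      simp only [map_sum, map_mul, AlgEquiv.commutes] at this
      have := congrArg (fun x : L => (x : ℂ)) this
      push_cast at this
      exact this
    have hkn : ∀ j, ‖ι (k j)‖ = t j * ‖ι n‖ := fun j => by
      have := congrArg norm (hk j)
      rw [norm_mul, norm_mul, hnorm, Complex.norm_real, Real.norm_of_nonneg (ht0 j), mul_one] at this
      exact this
    have hq : ∀ j, ‖ι (k j) * w j / ι n‖ = t j := fun j => by
      rw [norm_div, norm_mul, hw, hkn, mul_one, mul_div_assoc, div_self (norm_ne_zero_iff.2 hin),
        mul_one]
    have hre : ∀ j ∈ Finset.univ, (ι (k j) * w j / ι n).re ≤ t j := fun j _ => by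
      rw [← hq j]; exact Complex.re_le_norm _
    have hS : ∑ j, (ι (k j) * w j / ι n).re = ∑ j, t j := by
      rw [ht, ← Complex.re_sum, ← Finset.sum_div, hsumw, div_self hin, Complex.one_re]
    have heq := (Finset.sum_eq_sum_iff_of_le hre).1 hS i (Finset.mem_univ i)
    have h2 : ι (k i) * w i / ι n = t i := by
      have h3 := (Complex.re_eq_norm (z := ι (k i) * w i / ι n)).1 (heq.trans (hq i).symm)
      have h4 : (ι (k i) * w i / ι n).im = 0 := (Complex.le_def.1 h3).2.symm
      apply Complex.ext <;> simp [heq, h4]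
    rw [div_eq_iff hin, ← hk i] at h2
    have : w i = u i := mul_left_cancel₀ (by simpa using hki) h2
    exact Subtype.ext this
  have hbot : (⟨u i, huL i⟩ : L) ∈ (⊥ : IntermediateField K L) :=
    (InfiniteGalois.mem_bot_iff_fixed _).2 hfix
  obtain ⟨e, he⟩ := IntermediateField.mem_bot.1 hbot
  have he' : ι e = u i := congrArg (fun x : L => (x : ℂ)) he
  obtain ⟨m, hm, h⟩ := hu i
  have hem : e ^ m = 1 := by
    apply ι.injective
    rw [map_pow, he', h, map_one]
  have hint : IsIntegral ℤ e := IsIntegral.of_pow hm (by rw [hem]; exact isIntegral_one)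
  refine ⟨⟨e, hint⟩, ?_⟩
  change ι (k i) * u i = ι (e * k i)
  rw [map_mul, he', mul_comm]

theorem smem {K : Type*} [Field K] [NumberField K] (M : Submodule (𝓞 K) K) (e : 𝓞 K) (x : K)
    (hx : x ∈ M) : (e : K) * x ∈ M := by
  have := M.smul_mem e hx
  rwa [Algebra.smul_def] at this

theorem step {K : Type*} [Field K] [NumberField K] (ι : K →+* ℂ)
    (S : Finset ℂ) (hint : (interior (convexHull ℝ (S : Set ℂ))).Nonempty)
    (M : Submodule (𝓞 K) K) (lam c : ℂ)
    (hc : c • convexHull ℝ (S : Set ℂ) ∈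
      genSemiring {C : Set ℂ | ∃ h ∈ M, C = (ι h * lam) • convexHull ℝ (S : Set ℂ)}) :
    ∃ (J : Type) (_ : Fintype J) (k : J → K) (u : J → ℂˣ) (t : J → ℝ), (∀ i, k i ∈ M) ∧
      (∀ i, (u i : ℂ) • convexHull ℝ (S : Set ℂ) = convexHull ℝ (S : Set ℂ)) ∧
      (∀ i, 0 ≤ t i) ∧ ∑ i, t i = 1 ∧ ∀ i, ι (k i) * lam * u i = t i * c := by
  by_cases hc0 : c = 0
  · exact ⟨Unit, inferInstance, fun _ => 0, fun _ => 1, fun _ => 1, by simp, by simp, by simp,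
      by simp, by simp [hc0]⟩
  have hset : {C : Set ℂ | ∃ h ∈ M, C = (ι h * lam) • convexHull ℝ (S : Set ℂ)} =
      {C : Set ℂ | ∃ h ∈ {x : ℂ | ∃ q ∈ M, ι q * lam = x}, C = h • convexHull ℝ (S : Set ℂ)} := by
    ext C
    constructor
    · rintro ⟨h, hM, rfl⟩
      exact ⟨_, ⟨h, hM, rfl⟩, rfl⟩
    · rintro ⟨_, ⟨h, hM, rfl⟩, rfl⟩
      exact ⟨h, hM, rfl⟩
  rw [hset] at hc
  obtain ⟨J, iJ, h, u, t, hX, h1, h2, h3, h4⟩ := key_s15 S hint _ c hc0 hc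
  choose q hq hqe using hX
  exact ⟨J, iJ, q, u, t, hq, h1, h2, h3, fun i => by rw [hqe]; exact h4 i⟩

theorem gen_mem (G : Set (Set ℂ)) (C : Set ℂ) (h : C ∈ G) : C ∈ genSemiring G :=
  fun _ hT => hT.1 h

theorem transfer {K : Type*} [Field K] [NumberField K] (ι : K →+* ℂ)
    (S : Finset ℂ) (hint : (interior (convexHull ℝ (S : Set ℂ))).Nonempty)
    (U : Subgroup ℂˣ) (hU : ∀ z : ℂˣ, (z : ℂ) • convexHull ℝ (S : Set ℂ) =
      convexHull ℝ (S : Set ℂ) ↔ z ∈ U)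
    (M N : Submodule (𝓞 K) K) (lam mu : ℂ) (hl : lam ≠ 0)
    (heq : genSemiring {C : Set ℂ | ∃ h ∈ M, C = (ι h * lam) • convexHull ℝ (S : Set ℂ)} =
      genSemiring {C : Set ℂ | ∃ h ∈ N, C = (ι h * mu) • convexHull ℝ (S : Set ℂ)})
    (k : Kˣ) (u : ℂˣ) (hu : u ∈ U) (hmu : mu = (u : ℂ) * ι k * lam) (n : K) (hn : n ∈ N) :
    (k : K) * n ∈ M := by
  by_cases hn0 : n = 0
  · simp [hn0]
  have hmem : (ι n * mu) • convexHull ℝ (S : Set ℂ) ∈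
      genSemiring {C : Set ℂ | ∃ h ∈ M, C = (ι h * lam) • convexHull ℝ (S : Set ℂ)} := by
    rw [heq]; exact gen_mem _ _ ⟨n, hn, rfl⟩
  obtain ⟨J, iJ, q, v, t, hq, hv, ht0, ht, he⟩ := step ι S hint M lam _ hmem
  have he2 : ∀ i, ι (q i) * ((v i * u⁻¹ : ℂˣ) : ℂ) = t i * ι (k * n) := by
    intro i
    have h1 := he i
    rw [hmu] at h1
    have h2 : (u : ℂ) ≠ 0 := u.ne_zero
    push_cast
    rw [map_mul, ← div_eq_mul_inv, mul_div_assoc', div_eq_iff h2]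
    apply mul_right_cancel₀ hl
    linear_combination h1
  have hB := galB ι (k * n) (mul_ne_zero k.ne_zero hn0) q (fun i => ((v i * u⁻¹ : ℂˣ) : ℂ)) t
    (fun i => stab_norm S hint _ ((hU _).2 (U.mul_mem ((hU _).1 (hv i)) (U.inv_mem hu)))) ht0 ht he2
  choose e hee using hB
  have : (k : K) * n = ∑ i, (e i : K) * q i := by
    apply ι.injective
    rw [map_sum]
    simp_rw [← hee, he2]
    rw [← Finset.sum_mul, ← Complex.ofReal_sum, ht]; simp
  rw [this]
  exact M.sum_mem fun i _ => smem M _ _ (hq i)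

theorem find_k {K : Type*} [Field K] [NumberField K] (ι : K →+* ℂ)
    (S : Finset ℂ) (hint : (interior (convexHull ℝ (S : Set ℂ))).Nonempty)
    (U : Subgroup ℂˣ) (hU : ∀ z : ℂˣ, (z : ℂ) • convexHull ℝ (S : Set ℂ) =
      convexHull ℝ (S : Set ℂ) ↔ z ∈ U)
    (M N : Submodule (𝓞 K) K) (hN : N ≠ ⊥) (lam mu : ℂ) (hl : lam ≠ 0) (hm : mu ≠ 0)
    (heq : genSemiring {C : Set ℂ | ∃ h ∈ M, C = (ι h * lam) • convexHull ℝ (S : Set ℂ)} =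
      genSemiring {C : Set ℂ | ∃ h ∈ N, C = (ι h * mu) • convexHull ℝ (S : Set ℂ)}) :
    ∃ (k : Kˣ) (u : ℂˣ), u ∈ U ∧ mu = (u : ℂ) * ι k * lam := by
  obtain ⟨n, hn, hn0⟩ := Submodule.exists_mem_ne_zero_of_ne_bot hN
  have hmem : (ι n * mu) • convexHull ℝ (S : Set ℂ) ∈
      genSemiring {C : Set ℂ | ∃ h ∈ M, C = (ι h * lam) • convexHull ℝ (S : Set ℂ)} := by
    rw [heq]; exact gen_mem _ _ ⟨n, hn, rfl⟩
  obtain ⟨J, iJ, q, v, t, hq, hv, ht0, ht, he⟩ := step ι S hint M lam _ hmem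
  have hmem2 : ∀ i, (ι (q i) * lam) • convexHull ℝ (S : Set ℂ) ∈
      genSemiring {C : Set ℂ | ∃ h ∈ N, C = (ι h * mu) • convexHull ℝ (S : Set ℂ)} := by
    intro i
    rw [← heq]; exact gen_mem _ _ ⟨q i, hq i, rfl⟩
  choose J' iJ' q' v' t' hq' hv' ht0' ht' he' using fun i => step ι S hint N mu _ (hmem2 i)
  have hB := galB ι (J := Σ i, J' i) n hn0 (fun p => q' p.1 p.2)
    (fun p => ((v' p.1 p.2 * v p.1 : ℂˣ) : ℂ)) (fun p => t' p.1 p.2 * t p.1)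
    (fun p => stab_norm S hint _ ((hU _).2 (U.mul_mem ((hU _).1 (hv' _ _)) ((hU _).1 (hv _)))))
    (fun p => mul_nonneg (ht0' _ _) (ht0 _))
    (by
      rw [Fintype.sum_sigma]
      simp_rw [← Finset.sum_mul, ht', one_mul]
      exact ht)
    (by
      intro p
      have h1 := he p.1
      have h2 := he' p.1 p.2
      push_cast
      apply mul_right_cancel₀ hm
      linear_combination (v p.1 : ℂ) * h2 + (t' p.1 p.2 : ℂ) * h1)
  choose e hee using hB
  obtain ⟨i, hi⟩ : ∃ i, t i ≠ 0 := by
    by_contra hcon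
    push Not at hcon
    simp [hcon] at ht
  have hin : ι n ≠ 0 := by simpa using hn0
  have hqi : ι (q i) ≠ 0 := by
    intro h0
    have h1 := he i
    rw [h0] at h1
    have hti : (t i : ℂ) ≠ 0 := by exact_mod_cast hi
    simp [hti, hn0, hm] at h1
  set n' : K := ∑ j, (e ⟨i, j⟩ : K) * q' i j with hn'
  have hval : ι (q i) * lam * v i = mu * ι n' := by
    rw [hn', map_sum]
    have : ∀ j, ι ((e ⟨i, j⟩ : K) * q' i j) = ι (q' i j) * ((v' i j * v i : ℂˣ) : ℂ) :=
      fun j => (hee ⟨i, j⟩).symm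
    simp_rw [this]
    rw [Finset.mul_sum]
    have h2 : ∀ j, mu * (ι (q' i j) * ((v' i j * v i : ℂˣ) : ℂ)) =
        (t' i j : ℂ) * (ι (q i) * lam * v i) := by
      intro j
      push_cast
      linear_combination (v i : ℂ) * he' i j
    simp_rw [h2]
    rw [← Finset.sum_mul, ← Complex.ofReal_sum, ht']; simp
  have hn0' : n' ≠ 0 := by
    intro h0
    rw [h0] at hval
    have h3 : (v i : ℂ) ≠ 0 := (v i).ne_zero
    simp [hl, h3] at hval
    exact hqi (by simp [hval])
  have hq0 : q i ≠ 0 := fun h => hqi (by simp [h])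
  refine ⟨Units.mk0 (q i / n') (div_ne_zero hq0 hn0'), v i, (hU _).1 (hv i), ?_⟩
  have h4 : ι n' ≠ 0 := by simpa using hn0'
  rw [Units.val_mk0, map_div₀]
  field_simp
  linear_combination -hval

/-- `K` is an imaginary quadratic field of class number 1 (embedded in `ℂ`
by `ι`, with fundamental polygon `D_K` whose stabilizer in `ℂ*` is the unit group
`𝒰_K`).  `Q` stands for the quotient `𝔸^f_K/𝒪~_K^×` of the finite adèles, which comes
with an action of `K^×` and parametrizes, via `a ↦ H_a`, the nonzero
sub-`𝒪_K`-modules of `K` (with `H_{ka} = k⁻¹·H_a`).  The map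
`Φ(a, λ) = Semiring{h·λ·D_K : h ∈ H_a}` is invariant under the diagonal action of
`K^×`, and induces a bijection of the quotient of `Q × ℂ/𝒰_K` by this action onto the
set `𝒮_mod` of sub-semirings of `𝒞_{K,ℂ}` of the form `Semiring{h·D_K : h ∈ H}`,
`H` a sub-`𝒪_K`-module of `K`. -/
theorem stmt15 {K : Type*} [Field K] [NumberField K] (ι : K →+* ℂ)
    (D : Set ℂ)
    (hDpoly : ∃ S : Finset ℂ, D = convexHull ℝ (↑S : Set ℂ))
    (hDint : (interior D).Nonempty)
    (U : Subgroup ℂˣ) (hU : ∀ z : ℂˣ, (z : ℂ) • D = D ↔ z ∈ U)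
    -- `Q` is the quotient `𝔸^f_K/𝒪~_K^×`, with its `K^×`-action and its adelic
    -- parametrization `a ↦ H_a` of the nonzero sub-`𝒪_K`-modules of `K`
    (Q : Type*) [MulAction Kˣ Q] (H : Q → Submodule (𝓞 K) K)
    (hHne : ∀ a : Q, H a ≠ ⊥)
    (hHbij : ∀ M : Submodule (𝓞 K) K, M ≠ ⊥ → ∃! a : Q, H a = M)
    (hHact : ∀ (k : Kˣ) (a : Q),
      (H (k • a) : Set K) = (fun q : K => (k : K)⁻¹ * q) '' (H a : Set K))
    (Φ : Q → ℂ → Set (Set ℂ))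
    (hΦ : ∀ (a : Q) (lam : ℂ),
      Φ a lam = genSemiring {C : Set ℂ | ∃ h ∈ H a, C = (ι h * lam) • D}) :
    -- invariance under the diagonal action of `K^×`
    (∀ (k : Kˣ) (a : Q) (lam : ℂ), Φ (k • a) (ι k * lam) = Φ a lam) ∧
    -- injectivity modulo the diagonal action of `K^×` (and modulo `𝒰_K` on `ℂ`)
    (∀ (a b : Q) (lam mu : ℂ), lam ≠ 0 → mu ≠ 0 →
      (Φ a lam = Φ b mu ↔
        ∃ (k : Kˣ) (u : ℂˣ), u ∈ U ∧ b = k • a ∧ mu = (u : ℂ) * ι k * lam)) ∧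
    -- surjectivity onto `𝒮_mod`
    (∀ M : Submodule (𝓞 K) K, M ≠ ⊥ → ∃ (a : Q) (lam : ℂ),
      Φ a lam = genSemiring {C : Set ℂ | ∃ h ∈ M, C = (ι h) • D}) := by
  obtain ⟨S, rfl⟩ := hDpoly
  have hact : ∀ (k : Kˣ) (a : Q) (x : K), x ∈ H (k • a) ↔ (k : K) * x ∈ H a := by
    intro k a x
    rw [← SetLike.mem_coe, hHact]
    constructor
    · rintro ⟨q, hq, rfl⟩
      simpa using hq
    · intro h
      exact ⟨_, h, by simp⟩
  have part1 : ∀ (k : Kˣ) (a : Q) (lam : ℂ), Φ (k • a) (ι k * lam) = Φ a lam := by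
    intro k a lam
    rw [hΦ, hΦ]
    congr 1
    ext C
    constructor
    · rintro ⟨h, hh, rfl⟩
      exact ⟨k * h, (hact _ _ _).1 hh, by rw [map_mul]; congr 1; ring⟩
    · rintro ⟨h, hh, rfl⟩
      refine ⟨(k : K)⁻¹ * h, (hact _ _ _).2 (by simpa using hh), ?_⟩
      have : ι (k : K) ≠ 0 := by simp
      rw [map_mul, map_inv₀]
      congr 1
      field_simp
  refine ⟨part1, ?_, ?_⟩
  · intro a b lam mu hl hm
    constructor
    · intro heq
      rw [hΦ, hΦ] at heq
      obtain ⟨k, u, hu, hmu⟩ := find_k ι S hDint U hU (H a) (H b) (hHne b) lam mu hl hm heq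
      refine ⟨k, u, hu, ?_, hmu⟩
      refine (hHbij (H b) (hHne b)).unique rfl ?_
      ext x
      rw [hact]
      constructor
      · intro hx
        have hk : ι (k : K) ≠ 0 := by simp
        have := transfer ι S hDint U hU (H b) (H a) mu lam hm heq.symm k⁻¹ u⁻¹ (U.inv_mem hu)
          (by
            have : (u : ℂ) ≠ 0 := u.ne_zero
            rw [hmu]; push_cast; rw [map_inv₀]; field_simp) _ hx
        simpa using this
      · intro hx
        exact transfer ι S hDint U hU (H a) (H b) lam mu hl heq k u hu hmu x hx
    · rintro ⟨k, u, hu, rfl, rfl⟩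
      rw [← part1 k a lam, hΦ, hΦ]
      congr 1
      have : ∀ h : K, (ι h * ((u : ℂ) * ι k * lam)) • convexHull ℝ (S : Set ℂ) =
          (ι h * (ι k * lam)) • convexHull ℝ (S : Set ℂ) := by
        intro h
        conv_rhs => rw [← (hU u).2 hu]
        rw [smul_smul]
        congr 1
        ring
      simp_rw [this]
  · intro M hM
    obtain ⟨a, ha, -⟩ := hHbij M hM
    exact ⟨a, 1, by rw [hΦ, ha]; simp⟩
end
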